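/- Let ν be a nonnegative Radon measure on a bounded open Ω ⊂ ℝⁿ, 1 < p ≤ n, and suppose q ∈ (n/p, ∞] and ν has finite Morrey norm ‖ν‖_{M^q(Ω)}. Then for every compactly supported ε > 0 truncation, the truncated measures converge: ν is absolutely continuous with respect to p-capacity, i.e. if E ⊂ Ω is a Borel set with cap_p(E, Ω) = 0 then ν(E) = 0. -/

import Mathlib

open MeasureTheory Metric Set
open scoped ENNReal NNReal

/-- The variational `p`-capacity of a pair `K ⊆ U`, computed over smooth test functions
compactly supported in `U` that are `≥ 1` on `K`. -/
noncomputable def pCap (n : ℕ) (p : ℝ) (K U : Set (EuclideanSpace ℝ (Fin n))) : ℝ≥0∞ :=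
  ⨅ (u : EuclideanSpace ℝ (Fin n) → ℝ) (_ : ContDiff ℝ (⊤ : ℕ∞) u) (_ : HasCompactSupport u)
    (_ : tsupport u ⊆ U) (_ : ∀ x ∈ K, 1 ≤ u x),
    ∫⁻ x, (‖gradient u x‖₊ : ℝ≥0∞) ^ p

/-- The `p`-capacity of an arbitrary set `E ⊆ Ω`, obtained from the compact capacity by
Choquet's inner regularization over compacts and outer regularization over open sets. -/
noncomputable def pCapSet (n : ℕ) (p : ℝ) (E Ω : Set (EuclideanSpace ℝ (Fin n))) : ℝ≥0∞ :=
  ⨅ (U : Set (EuclideanSpace ℝ (Fin n))) (_ : IsOpen U) (_ : E ⊆ U) (_ : U ⊆ Ω),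
    ⨆ (K : Set (EuclideanSpace ℝ (Fin n))) (_ : IsCompact K) (_ : K ⊆ U), pCap n p K Ω

section Potential

variable {V : Type*} [NormedAddCommGroup V] [NormedSpace ℝ V]

theorem enorm_le_lintegral_fderiv_segment {u : V → ℝ} (hu : ContDiff ℝ 1 u) {x z : V} {T : ℝ}
    (hT : 0 ≤ T) (h0 : u (x + T • z) = 0) :
    ‖u x‖ₑ ≤ ∫⁻ t in Icc 0 T, ‖fderiv ℝ u (x + t • z)‖ₑ * ‖z‖ₑ := by
  have hcd : ContDiff ℝ 1 fun t : ℝ => u (x + t • z) := by fun_prop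
  have h := enorm_sub_le_lintegral_deriv_of_contDiffOn_Icc hcd.contDiffOn hT
  simp only [h0, zero_smul, add_zero, zero_sub, enorm_neg] at h
  refine h.trans (lintegral_mono fun t => ?_)
  have hd : HasDerivAt (fun t : ℝ => u (x + t • z)) (fderiv ℝ u (x + t • z) z) t := by
    have h1 : HasDerivAt (fun t : ℝ => x + t • z) z t := by
      simpa using ((hasDerivAt_id t).smul_const z).const_add x
    exact ((hu.differentiable one_ne_zero _).hasFDerivAt).comp_hasDerivAt t h1
  rw [hd.deriv]
  exact ContinuousLinearMap.le_opENorm _ _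

variable [FiniteDimensional ℝ V] [MeasurableSpace V] [BorelSpace V]

theorem lintegral_ball_comp_add_smul (μ : Measure V) [μ.IsAddHaarMeasure] {G : V → ℝ≥0∞}
    (hG : Measurable G) (x : V) {t : ℝ} (ht : 0 < t) (ρ : ℝ) :
    ∫⁻ z in ball 0 ρ, G (x + t • z) ∂μ
      = ENNReal.ofReal ((t ^ Module.finrank ℝ V)⁻¹) * ∫⁻ y in ball x (t * ρ), G y ∂μ := by
  have h1 : ∫⁻ z in ball 0 ρ, G (x + t • z) ∂μ
      = ∫⁻ z, (ball x (t * ρ)).indicator G (x + t • z) ∂μ := by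
    rw [← lintegral_indicator measurableSet_ball]
    refine lintegral_congr fun z => ?_
    simp only [indicator, mem_ball, dist_zero_right, dist_self_add_left, norm_smul,
      Real.norm_of_nonneg ht.le, mul_lt_mul_iff_right₀ ht]
  have hI : Measurable ((ball x (t * ρ)).indicator G) := hG.indicator measurableSet_ball
  have h2 := lintegral_map (μ := μ) (hI.comp (measurable_const_add x)) (measurable_const_smul t)
  simp only [Function.comp_def] at h2
  rw [h1, ← h2, Measure.map_addHaar_smul μ ht.ne', lintegral_smul_measure,
    lintegral_add_left_eq_self (μ := μ) ((ball x (t * ρ)).indicator G) x,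
    lintegral_indicator measurableSet_ball, abs_of_pos (by positivity), smul_eq_mul]

theorem lintegral_lintegral_ball_comp_add_smul_le (μ : Measure V) [μ.IsAddHaarMeasure]
    (ν : Measure V) [SFinite ν] {G : V → ℝ≥0∞} (hG : Measurable G) {t : ℝ} (ht : 0 < t) {ρ : ℝ}
    {c : ℝ≥0∞} (hc : ∀ y, ν (ball y (t * ρ)) ≤ c) :
    ∫⁻ x, ∫⁻ z in ball 0 ρ, G (x + t • z) ∂μ ∂ν
      ≤ ENNReal.ofReal ((t ^ Module.finrank ℝ V)⁻¹) * (c * ∫⁻ y, G y ∂μ) := by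
  simp_rw [lintegral_ball_comp_add_smul μ hG _ ht ρ]
  rw [lintegral_const_mul' _ _ ENNReal.ofReal_ne_top]
  gcongr
  have hS : MeasurableSet {w : V × V | dist w.2 w.1 < t * ρ} :=
    (isOpen_lt (by fun_prop) continuous_const).measurableSet
  have h1 : ∀ x, ∫⁻ y in ball x (t * ρ), G y ∂μ
      = ∫⁻ y, {w : V × V | dist w.2 w.1 < t * ρ}.indicator (fun w => G w.2) (x, y) ∂μ := fun x => by
    rw [← lintegral_indicator measurableSet_ball]
    rfl
  simp_rw [h1]
  rw [lintegral_lintegral_swap, ← lintegral_const_mul _ hG]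
  · refine lintegral_mono fun y => ?_
    have h2 : ∫⁻ x, {w : V × V | dist w.2 w.1 < t * ρ}.indicator (fun w => G w.2) (x, y) ∂ν
        = ∫⁻ x, (ball y (t * ρ)).indicator (fun _ => G y) x ∂ν := by
      refine lintegral_congr fun x => ?_
      simp only [indicator, mem_ofPred_eq, mem_ball, dist_comm]
    rw [h2, lintegral_indicator_const measurableSet_ball, mul_comm]
    gcongr
    exact hc y
  · exact ((hG.comp measurable_snd).indicator hS).aemeasurable

theorem lintegral_le_rpow_lintegral_rpow {α : Type*} [MeasurableSpace α] (μ : Measure α)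
    {p q : ℝ} (hpq : p.HolderConjugate q) {f : α → ℝ≥0∞} (hf : AEMeasurable f μ) :
    ∫⁻ a, f a ∂μ ≤ (∫⁻ a, f a ^ p ∂μ) ^ (1 / p) * μ univ ^ (1 / q) := by
  simpa using ENNReal.lintegral_mul_le_Lp_mul_Lq μ hpq hf (aemeasurable_const (b := (1 : ℝ≥0∞)))

theorem lintegral_enorm_mul_le_of_growth (μ : Measure V) [μ.IsAddHaarMeasure]
    (ν : Measure V) [IsFiniteMeasure ν] {p q : ℝ} (hpq : p.HolderConjugate q) {M s : ℝ}
    (hν : ∀ x r, 0 < r → ν (ball x r) ≤ ENNReal.ofReal (M * r ^ s)) {R : ℝ} (hR : 0 ≤ R)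
    (hνR : ∀ᵐ x ∂ν, x ∈ ball 0 R) {e : V} (he : ‖e‖ = 2) {u : V → ℝ} (hu : ContDiff ℝ 1 u)
    (h0 : ∀ x, x ∉ ball (0 : V) R → u x = 0) :
    (∫⁻ x, ‖u x‖ₑ ∂ν) * μ (ball e 1) ≤
      (∫⁻ t in Icc 0 (2 * R), 3 * ((ENNReal.ofReal ((t ^ Module.finrank ℝ V)⁻¹) *
          ENNReal.ofReal (M * (t * 3) ^ s)) ^ (1 / p) * (ν univ * μ (ball e 1)) ^ (1 / q))) *
        (∫⁻ x, ‖fderiv ℝ u x‖ₑ ^ p ∂μ) ^ (1 / p) := by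
  have hcont : Continuous (fderiv ℝ u) := hu.continuous_fderiv one_ne_zero
  set g : V → ℝ≥0∞ := fun y => ‖fderiv ℝ u y‖ₑ with hg
  have hgm : Measurable g := hcont.enorm.measurable
  have hnorm : ∀ z ∈ ball e 1, 1 ≤ ‖z‖ ∧ ‖z‖ < 3 := fun z hz => by
    rw [mem_ball, dist_eq_norm] at hz
    have h1 := norm_sub_norm_le e z
    have h2 := norm_sub_norm_le z e
    rw [norm_sub_rev] at h1
    constructor <;> linarith
  have hpt : ∀ᵐ x ∂ν, ‖u x‖ₑ * μ (ball e 1)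
      ≤ ∫⁻ z in ball e 1, (∫⁻ t in Icc 0 (2 * R), 3 * g (x + t • z)) ∂μ := by
    filter_upwards [hνR] with x hx
    rw [← setLIntegral_const]
    refine setLIntegral_mono' measurableSet_ball fun z hz => ?_
    obtain ⟨hz1, hz3⟩ := hnorm z hz
    have hout : x + (2 * R) • z ∉ ball (0 : V) R := by
      rw [mem_ball_zero_iff] at hx ⊢
      have h1 := norm_sub_le (x + (2 * R) • z) x
      rw [add_sub_cancel_left, norm_smul, Real.norm_of_nonneg (by positivity)] at h1
      nlinarith
    refine (enorm_le_lintegral_fderiv_segment hu (by positivity) (h0 _ hout)).trans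
      (lintegral_mono fun t => ?_)
    rw [mul_comm]
    gcongr
    rw [← ofReal_norm, show (3 : ℝ≥0∞) = ENNReal.ofReal 3 by simp]
    exact ENNReal.ofReal_le_ofReal hz3.le
  have hmeas1 : ∀ x, Measurable (Function.uncurry fun (z : V) (t : ℝ) => 3 * g (x + t • z)) :=
    fun x => (hgm.comp (by fun_prop : Measurable fun w : V × ℝ => x + w.2 • w.1)).const_mul 3
  have hmeas2 : ∀ t : ℝ, Measurable fun w : V × V => g (w.1 + t • w.2) :=
    fun t => hgm.comp (by fun_prop)
  have hmeas3 : Measurable fun w : (V × ℝ) × V => 3 * g (w.1.1 + w.1.2 • w.2) :=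
    (hgm.comp (by fun_prop)).const_mul 3
  rw [← lintegral_mul_const _ hu.continuous.enorm.measurable]
  calc ∫⁻ x, ‖u x‖ₑ * μ (ball e 1) ∂ν
      ≤ ∫⁻ x, ∫⁻ z in ball e 1, (∫⁻ t in Icc 0 (2 * R), 3 * g (x + t • z)) ∂μ ∂ν :=
        lintegral_mono_ae hpt
    _ = ∫⁻ x, (∫⁻ t in Icc 0 (2 * R), ∫⁻ z in ball e 1, 3 * g (x + t • z) ∂μ) ∂ν :=
        lintegral_congr fun x => lintegral_lintegral_swap (hmeas1 x).aemeasurable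
    _ = ∫⁻ t in Icc 0 (2 * R), ∫⁻ x, ∫⁻ z in ball e 1, 3 * g (x + t • z) ∂μ ∂ν :=
        lintegral_lintegral_swap hmeas3.lintegral_prod_right'.aemeasurable
    _ ≤ ∫⁻ t in Icc 0 (2 * R), 3 * ((ENNReal.ofReal ((t ^ Module.finrank ℝ V)⁻¹) *
          ENNReal.ofReal (M * (t * 3) ^ s)) ^ (1 / p) * (ν univ * μ (ball e 1)) ^ (1 / q)) *
        (∫⁻ x, g x ^ p ∂μ) ^ (1 / p) := by
        rw [restrict_Ioc_eq_restrict_Icc.symm]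
        refine setLIntegral_mono' measurableSet_Ioc fun t ht => ?_
        have hprod : ∀ f : V × V → ℝ≥0∞, Measurable f →
            ∫⁻ x, ∫⁻ z in ball e 1, f (x, z) ∂μ ∂ν = ∫⁻ w, f w ∂(ν.prod (μ.restrict (ball e 1))) :=
          fun f hf => (lintegral_prod _ hf.aemeasurable).symm
        rw [hprod (fun w => 3 * g (w.1 + t • w.2)) ((hmeas2 t).const_mul 3),
          lintegral_const_mul _ (hmeas2 t), mul_assoc]
        gcongr
        refine (lintegral_le_rpow_lintegral_rpow _ hpq (hmeas2 t).aemeasurable).trans ?_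
        rw [← univ_prod_univ, Measure.prod_prod, Measure.restrict_apply_univ, mul_right_comm,
          ← ENNReal.mul_rpow_of_nonneg _ _ (one_div_nonneg.2 hpq.nonneg)]
        gcongr
        · exact one_div_nonneg.2 hpq.nonneg
        rw [← hprod (fun w => g (w.1 + t • w.2) ^ p) ((hmeas2 t).pow_const p), mul_assoc]
        refine le_trans (lintegral_mono fun x => lintegral_mono_set fun z hz => ?_)
          (lintegral_lintegral_ball_comp_add_smul_le μ ν (hgm.pow_const p) ht.1 (ρ := 3)
            fun y => hν y _ (by have := ht.1; positivity))
        rw [mem_ball_zero_iff]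
        exact (hnorm z hz).2
    _ = _ := lintegral_mul_const _ (by fun_prop)

end Potential

theorem setLIntegral_growth_kernel_lt_top {d : ℕ} {p q M s T : ℝ} (hpq : p.HolderConjugate q)
    (hs : (d : ℝ) - p < s) (hT : 0 ≤ T) {a : ℝ≥0∞} (ha : a ≠ ∞) :
    ∫⁻ t in Icc 0 T, 3 * ((ENNReal.ofReal ((t ^ d)⁻¹) *
      ENNReal.ofReal (M * (t * 3) ^ s)) ^ (1 / p) * a ^ (1 / q)) < ∞ := by
  have hp := hpq.pos
  have hb : a ^ (1 / q) ≠ ∞ := ENNReal.rpow_ne_top_of_nonneg (one_div_nonneg.2 hpq.symm.nonneg) ha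
  set c : ℝ≥0∞ := 3 * (ENNReal.ofReal (M * 3 ^ s)) ^ (1 / p) * a ^ (1 / q) with hc
  have hc_top : c ≠ ∞ := by
    refine ENNReal.mul_ne_top (ENNReal.mul_ne_top (by simp) ?_) hb
    exact ENNReal.rpow_ne_top_of_nonneg (one_div_nonneg.2 hp.le) ENNReal.ofReal_ne_top
  have hexp : -1 < (s - d) / p := by
    rw [lt_div_iff₀ hp]
    linarith
  have hint : IntegrableOn (fun t : ℝ => t ^ ((s - d) / p)) (Ioc 0 T) := by
    have := intervalIntegral.intervalIntegrable_rpow' (a := 0) (b := T) hexp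
    rwa [intervalIntegrable_iff_integrableOn_Ioc_of_le hT] at this
  rw [restrict_Ioc_eq_restrict_Icc.symm]
  calc _ = ∫⁻ t in Ioc 0 T, c * ENNReal.ofReal (t ^ ((s - d) / p)) := by
        refine setLIntegral_congr_fun measurableSet_Ioc fun t ht => ?_
        have ht0 := ht.1
        have h1 : (t ^ d)⁻¹ * (M * (t * 3) ^ s) = t ^ (s - d) * (M * 3 ^ s) := by
          rw [Real.mul_rpow ht0.le (by norm_num), Real.rpow_sub ht0, Real.rpow_natCast]
          ring
        rw [← ENNReal.ofReal_mul (by positivity), h1, ENNReal.ofReal_mul (by positivity),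
          ENNReal.mul_rpow_of_nonneg _ _ (one_div_nonneg.2 hp.le),
          ENNReal.ofReal_rpow_of_nonneg (by positivity) (one_div_nonneg.2 hp.le),
          ← Real.rpow_mul ht0.le, mul_one_div, hc]
        ring
    _ < ∞ := by
        rw [lintegral_const_mul' _ _ hc_top]
        exact ENNReal.mul_lt_top hc_top.lt_top hint.setLIntegral_lt_top

theorem enorm_gradient {F : Type*} [NormedAddCommGroup F] [InnerProductSpace ℝ F] [CompleteSpace F]
    (u : F → ℝ) (x : F) : ‖gradient u x‖ₑ = ‖fderiv ℝ u x‖ₑ := by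
  rw [gradient, ← ofReal_norm, LinearIsometryEquiv.norm_map, ofReal_norm]

theorem exists_mul_measure_rpow_le_pCap {n : ℕ} {p : ℝ} (hp : 1 < p) (hn : 0 < n) {s : ℝ}
    (hs : (n : ℝ) - p < s) {Ω : Set (EuclideanSpace ℝ (Fin n))} (hΩb : Bornology.IsBounded Ω)
    (ν : Measure (EuclideanSpace ℝ (Fin n))) [IsFiniteMeasure ν] (hνΩ : ν Ωᶜ = 0) {M : ℝ}
    (hν : ∀ x r, 0 < r → ν (ball x r) ≤ ENNReal.ofReal (M * r ^ s)) :
    ∃ c : ℝ≥0∞, c ≠ 0 ∧ ∀ K, IsCompact K → (c * ν K) ^ p ≤ pCap n p K Ω := by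
  have hpq := Real.HolderConjugate.conjExponent hp
  obtain ⟨R, hR, hΩR⟩ : ∃ R, 0 ≤ R ∧ Ω ⊆ ball 0 R := by
    obtain ⟨R, hR, h⟩ := hΩb.subset_ball_lt 0 0
    exact ⟨R, hR.le, h⟩
  set e : EuclideanSpace ℝ (Fin n) := EuclideanSpace.single ⟨0, hn⟩ 2
  have he : ‖e‖ = 2 := by simp [e]
  set B := (volume : Measure (EuclideanSpace ℝ (Fin n))) (ball e 1) with hB_def
  have hB0 : B ≠ 0 := (measure_ball_pos _ _ one_pos).ne'
  have hB : B ≠ ∞ := measure_ball_lt_top.ne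
  set A := ∫⁻ t in Icc 0 (2 * R), 3 * ((ENNReal.ofReal ((t ^ n)⁻¹) *
      ENNReal.ofReal (M * (t * 3) ^ s)) ^ (1 / p) * (ν univ * B) ^ (1 / p.conjExponent)) with hA_def
  have hA : A < ∞ := setLIntegral_growth_kernel_lt_top hpq hs (by positivity)
    (ENNReal.mul_ne_top (measure_ne_top _ _) hB)
  have hA1 : A + 1 ≠ ∞ := by finiteness
  refine ⟨B / (A + 1), ENNReal.div_ne_zero.2 ⟨hB0, hA1⟩, fun K hK => ?_⟩
  have hp0 : 0 < p := hpq.pos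
  refine le_iInf fun u => le_iInf fun hu => le_iInf fun _ => le_iInf fun hsupp =>
    le_iInf fun hK1 => ?_
  have hνR : ∀ᵐ x ∂ν, x ∈ ball (0 : EuclideanSpace ℝ (Fin n)) R := by
    filter_upwards [measure_eq_zero_iff_ae_notMem.1 hνΩ] with x hx
    exact hΩR (not_not.1 hx)
  have hout : ∀ x, x ∉ ball (0 : EuclideanSpace ℝ (Fin n)) R → u x = 0 := fun x hx =>
    image_eq_zero_of_notMem_tsupport fun h => hx (hΩR (hsupp h))
  have hmain := lintegral_enorm_mul_le_of_growth volume ν hpq hν hR hνR he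
    (hu.of_le (by simp)) hout
  rw [finrank_euclideanSpace_fin, ← hB_def, ← hA_def] at hmain
  have hKu : ν K ≤ ∫⁻ x, ‖u x‖ₑ ∂ν := by
    rw [← setLIntegral_one]
    refine (setLIntegral_mono' hK.measurableSet fun x hx => ?_).trans (setLIntegral_le_lintegral _ _)
    rw [Real.enorm_eq_ofReal_abs, ← ENNReal.ofReal_one]
    exact ENNReal.ofReal_le_ofReal ((hK1 x hx).trans (le_abs_self _))
  have hgrad : ∫⁻ x, (‖gradient u x‖₊ : ℝ≥0∞) ^ p = ∫⁻ x, ‖fderiv ℝ u x‖ₑ ^ p :=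
    lintegral_congr fun x => by rw [← enorm_gradient, enorm_eq_nnnorm]
  rw [hgrad, ← ENNReal.le_rpow_inv_iff hp0, ← one_div, mul_comm, ← mul_div_assoc]
  refine ENNReal.div_le_of_le_mul' ?_
  calc _ ≤ (∫⁻ x, ‖u x‖ₑ ∂ν) * B := by gcongr
    _ ≤ _ := hmain
    _ ≤ _ := by gcongr; exact le_self_add

/-- A nonnegative measure on a bounded open `Ω ⊂ ℝⁿ` with finite Morrey norm `M^q(Ω)` for
some `q > n/p` (`1 < p ≤ n`) is absolutely continuous with respect to the `p`-capacity:
Borel sets of zero `p`-capacity are `ν`-null. -/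
theorem morrey_measure_null_on_polar (n : ℕ) (p : ℝ) (hp : 1 < p) (hpn : p ≤ (n : ℝ))
    (q : ℝ≥0∞) (hq : ENNReal.ofReal ((n : ℝ) / p) < q)
    (Ω : Set (EuclideanSpace ℝ (Fin n))) (hΩo : IsOpen Ω) (hΩb : Bornology.IsBounded Ω)
    (ν : Measure (EuclideanSpace ℝ (Fin n))) (hνΩ : ν Ωᶜ = 0) (M : ℝ)
    (hMorrey : ∀ (x : EuclideanSpace ℝ (Fin n)) (r : ℝ), 0 < r →
      ν (Ω ∩ ball x r) ≤ ENNReal.ofReal (M * r ^ ((n : ℝ) * (1 - 1 / q.toReal)))) :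
    ∀ E : Set (EuclideanSpace ℝ (Fin n)), MeasurableSet E → E ⊆ Ω →
      pCapSet n p E Ω = 0 → ν E = 0 := by
  have hp0 : 0 < p := by linarith
  have hn0 : (0 : ℝ) < n := by linarith
  have hs : (n : ℝ) - p < n * (1 - 1 / q.toReal) := by
    rcases eq_or_ne q ∞ with rfl | hq_top
    · simpa using hp0
    · have h1 : (n : ℝ) / p < q.toReal :=
        (ENNReal.ofReal_lt_iff_lt_toReal (by positivity) hq_top).1 hq
      have h2 : 0 < q.toReal := lt_trans (by positivity) h1
      have h3 : (n : ℝ) / q.toReal < p := by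
        rw [div_lt_iff₀ hp0] at h1
        rwa [div_lt_iff₀ h2, mul_comm]
      rw [mul_sub, mul_one_div, mul_one]
      linarith
  have hνball : ∀ x r, 0 < r → ν (ball x r) ≤
      ENNReal.ofReal (M * r ^ ((n : ℝ) * (1 - 1 / q.toReal))) := fun x r hr => by
    rw [← measure_inter_add_sdiff (ball x r) hΩo.measurableSet,
      measure_mono_null (fun y hy => hy.2 : ball x r \ Ω ⊆ Ωᶜ) hνΩ, add_zero, inter_comm]
    exact hMorrey x r hr
  have hfin : IsFiniteMeasure ν := by
    obtain ⟨R, hR, hΩR⟩ := hΩb.subset_ball_lt 0 0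
    refine ⟨?_⟩
    rw [← union_compl_self Ω]
    refine (measure_union_le _ _).trans_lt ?_
    rw [hνΩ, add_zero]
    exact ((measure_mono hΩR).trans (hνball 0 R hR)).trans_lt ENNReal.ofReal_lt_top
  obtain ⟨c, hc0, hc⟩ := exists_mul_measure_rpow_le_pCap hp (by exact_mod_cast hn0) hs hΩb ν hνΩ
    hνball
  intro E _ _ hcap
  have hle : (c * ν E) ^ p ≤ pCapSet n p E Ω := by
    refine le_iInf fun U => le_iInf fun hU => le_iInf fun hEU => le_iInf fun _ => ?_
    rw [← ENNReal.le_rpow_inv_iff hp0]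
    refine (mul_le_mul_right (measure_mono hEU) c).trans ?_
    rw [hU.measure_eq_iSup_isCompact]
    simp_rw [ENNReal.mul_iSup]
    refine iSup_le fun K => iSup_le fun hKU => iSup_le fun hK => ?_
    rw [ENNReal.le_rpow_inv_iff hp0]
    exact (hc K hK).trans (le_iSup_of_le K (le_iSup_of_le hK (le_iSup_of_le hKU le_rfl)))
  rw [hcap, nonpos_iff_eq_zero, ENNReal.rpow_eq_zero_iff_of_pos hp0, mul_eq_zero] at hle
  exact hle.resolve_left hc0
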